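/- π²/6 = Σ_{n=0}^∞ [(1)_n³ / (1/2)_n³] · (21n³ + 55n² + 47n + 13) / (2(2n+1)³(2n+2)²) · (1/64)^n. -/

import Mathlib

open Real

/-- The Pochhammer symbol (rising factorial): `poch a n = a (a+1) ⋯ (a+n-1)`. -/
noncomputable def poch (a : ℝ) (n : ℕ) : ℝ := (ascPochhammer ℝ n).eval a

open Filter Topology

theorem poch_zero (a : ℝ) : poch a 0 = 1 := by
  simp [poch]

theorem poch_succ (a : ℝ) (n : ℕ) : poch a (n + 1) = poch a n * (a + n) := by
  simp [poch, ascPochhammer_succ_eval]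

theorem poch_pos {a : ℝ} (ha : 0 < a) (n : ℕ) : 0 < poch a n :=
  ascPochhammer_pos n a ha

theorem poch_one_div_poch_half (n : ℕ) :
    poch 1 n / poch (1 / 2) n = (n.factorial : ℝ) ^ 2 * 4 ^ n / (2 * n).factorial := by
  induction n with
  | zero => simp [poch_zero]
  | succ n ih =>
    have hp := (poch_pos (a := 1 / 2) (by norm_num) n).ne'
    have hf : ((2 * n).factorial : ℝ) ≠ 0 := by positivity
    rw [poch_succ, poch_succ, mul_div_mul_comm, ih, show 2 * (n + 1) = 2 * n + 1 + 1 by ring,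
      Nat.factorial_succ, Nat.factorial_succ, Nat.factorial_succ]
    push_cast
    have h1 : (1 / 2 + (n : ℝ)) ≠ 0 := by positivity
    field_simp
    ring

/-- The first member of the Wilf–Zeilberger pair accelerating `∑ 1 / (k + 1) ^ 2`. -/
noncomputable def wzF (n k : ℕ) : ℝ :=
  (n.factorial : ℝ) ^ 4 * ((n + k).factorial : ℝ) ^ 2 /
    ((2 * n).factorial * ((2 * n + k + 1).factorial : ℝ) ^ 2)

/-- The numerator of the rational certificate of the Wilf–Zeilberger pair. -/
noncomputable def wzNum (n k : ℝ) : ℝ :=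
  2 * k ^ 3 + (13 * n + 11) * k ^ 2 + (28 * n ^ 2 + 48 * n + 20) * k
    + (21 * n ^ 3 + 55 * n ^ 2 + 47 * n + 13)

/-- The second member of the Wilf–Zeilberger pair accelerating `∑ 1 / (k + 1) ^ 2`. -/
noncomputable def wzG (n k : ℕ) : ℝ :=
  wzF n k * (wzNum n k / (2 * (2 * n + 1) * (2 * n + k + 2) ^ 2))

theorem wzF_nonneg (n k : ℕ) : 0 ≤ wzF n k := by
  unfold wzF; positivity

theorem wzNum_nonneg (n k : ℕ) : 0 ≤ wzNum n k := by
  unfold wzNum; positivity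

theorem wzG_nonneg (n k : ℕ) : 0 ≤ wzG n k :=
  mul_nonneg (wzF_nonneg n k) (div_nonneg (wzNum_nonneg n k) (by positivity))

theorem wzF_zero_left (k : ℕ) : wzF 0 k = 1 / ((k : ℝ) + 1) ^ 2 := by
  have h : (k.factorial : ℝ) ≠ 0 := by positivity
  simp only [wzF, mul_zero, zero_add, Nat.factorial_succ, Nat.factorial_zero]
  push_cast
  field_simp

theorem wzF_succ_left (n k : ℕ) : wzF (n + 1) k = wzF n k *
    (((n : ℝ) + 1) ^ 3 * (n + k + 1) ^ 2 /
      (2 * (2 * n + 1) * (2 * n + k + 2) ^ 2 * (2 * n + k + 3) ^ 2)) := by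
  have h1 : ((2 * n).factorial : ℝ) ≠ 0 := by positivity
  have h2 : ((2 * n + k + 1).factorial : ℝ) ≠ 0 := by positivity
  simp only [wzF]
  rw [show n + 1 + k = n + k + 1 by ring, show 2 * (n + 1) + k + 1 = 2 * n + k + 1 + 1 + 1 by ring,
    show 2 * (n + 1) = 2 * n + 1 + 1 by ring, Nat.factorial_succ n, Nat.factorial_succ (n + k),
    Nat.factorial_succ (2 * n + 1), Nat.factorial_succ (2 * n),
    Nat.factorial_succ (2 * n + k + 1 + 1), Nat.factorial_succ (2 * n + k + 1)]
  push_cast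
  rw [show (2 * (n : ℝ) + k + 1 + 1) = 2 * n + k + 2 by ring,
    show (2 * (n : ℝ) + k + 2 + 1) = 2 * n + k + 3 by ring,
    show (2 * (n : ℝ) + 1 + 1) = 2 * (n + 1) by ring]
  field_simp

theorem wzF_succ_right (n k : ℕ) : wzF n (k + 1) = wzF n k *
    (((n : ℝ) + k + 1) ^ 2 / (2 * n + k + 2) ^ 2) := by
  have h1 : ((2 * n).factorial : ℝ) ≠ 0 := by positivity
  have h2 : ((2 * n + k + 1).factorial : ℝ) ≠ 0 := by positivity
  simp only [wzF]
  rw [show n + (k + 1) = n + k + 1 by ring, show 2 * n + (k + 1) + 1 = 2 * n + k + 1 + 1 by ring,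
    Nat.factorial_succ (n + k), Nat.factorial_succ (2 * n + k + 1)]
  push_cast
  rw [show (2 * (n : ℝ) + k + 1 + 1) = 2 * n + k + 2 by ring]
  field_simp

theorem wzF_sub_wzF (n k : ℕ) : wzF n k - wzF (n + 1) k = wzG n k - wzG n (k + 1) := by
  rw [wzG, wzG, wzF_succ_left, wzF_succ_right]
  push_cast
  rw [show (2 * (n : ℝ) + (k + 1) + 2) = 2 * n + k + 3 by ring, wzNum, wzNum]
  have h2 : (2 * (n : ℝ) + k + 2) ≠ 0 := by positivity
  have h3 : (2 * (n : ℝ) + k + 3) ≠ 0 := by positivity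
  field_simp
  ring

theorem wzF_succ_left_le (n k : ℕ) : wzF (n + 1) k ≤ wzF n k * (1 / 2) := by
  rw [wzF_succ_left]
  refine mul_le_mul_of_nonneg_left ?_ (wzF_nonneg n k)
  rw [div_le_div_iff₀ (by positivity) (by norm_num)]
  have h1 : ((n : ℝ) + k + 1) ^ 2 ≤ (2 * n + k + 2) ^ 2 := by
    gcongr <;> linarith [Nat.cast_nonneg (α := ℝ) n]
  have h2 : ((n : ℝ) + 1) ^ 3 ≤ (2 * n + 1) * (2 * n + k + 3) ^ 2 := by
    have : ((n : ℝ) + 1) ^ 2 ≤ (2 * n + k + 3) ^ 2 := by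
      gcongr <;> linarith [Nat.cast_nonneg (α := ℝ) n, Nat.cast_nonneg (α := ℝ) k]
    have h : (n : ℝ) + 1 ≤ 2 * n + 1 := by linarith [Nat.cast_nonneg (α := ℝ) n]
    calc ((n : ℝ) + 1) ^ 3 = (n + 1) * (n + 1) ^ 2 := by ring
      _ ≤ _ := by gcongr
  have := mul_le_mul h2 h1 (by positivity) (by positivity)
  linarith

theorem wzF_le (n k : ℕ) : wzF n k ≤ (1 / 2) ^ n * (1 / ((k : ℝ) + 1) ^ 2) := by
  induction n with
  | zero => simp [wzF_zero_left]
  | succ n ih =>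
    have := wzF_succ_left_le n k
    rw [pow_succ]
    linarith

theorem hasSum_one_div_succ_sq :
    HasSum (fun k : ℕ => 1 / ((k : ℝ) + 1) ^ 2) (π ^ 2 / 6) := by
  have h := (hasSum_nat_add_iff' 1).mpr hasSum_zeta_two
  simpa using h

theorem summable_wzF (n : ℕ) : Summable (wzF n) :=
  .of_nonneg_of_le (wzF_nonneg n) (wzF_le n) (hasSum_one_div_succ_sq.summable.mul_left _)

theorem wzG_le (n k : ℕ) : wzG n k ≤ wzNum n 1 * (1 / ((k : ℝ) + 1)) := by
  have hF : wzF n k ≤ 1 / ((k : ℝ) + 1) ^ 2 :=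
    (wzF_le n k).trans (mul_le_of_le_one_left (by positivity)
      (pow_le_one₀ (by norm_num) (by norm_num)))
  have hk : (0 : ℝ) ≤ k := Nat.cast_nonneg k
  have hn : (0 : ℝ) ≤ n := Nat.cast_nonneg n
  have hp : wzNum n k ≤ wzNum n 1 * ((k : ℝ) + 1) ^ 3 := by
    rw [← sub_nonneg]
    unfold wzNum
    ring_nf
    positivity
  have hC : 0 ≤ wzNum n 1 := by simpa using wzNum_nonneg n 1
  have hR : wzNum n k / (2 * (2 * n + 1) * (2 * n + k + 2) ^ 2) ≤ wzNum n 1 * ((k : ℝ) + 1) := by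
    rw [div_le_iff₀ (by positivity)]
    have h : ((k : ℝ) + 1) ^ 2 ≤ 2 * (2 * n + 1) * (2 * n + k + 2) ^ 2 := by
      have : ((k : ℝ) + 1) ^ 2 ≤ (2 * n + k + 2) ^ 2 := by
        gcongr <;> linarith
      nlinarith [mul_nonneg hn (sq_nonneg (2 * (n : ℝ) + k + 2)), sq_nonneg (2 * (n : ℝ) + k + 2)]
    calc wzNum n k ≤ wzNum n 1 * ((k : ℝ) + 1) * ((k : ℝ) + 1) ^ 2 := by linarith
      _ ≤ _ := by gcongr
  calc wzG n k ≤ 1 / ((k : ℝ) + 1) ^ 2 * (wzNum n 1 * ((k : ℝ) + 1)) :=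
        mul_le_mul hF hR (div_nonneg (wzNum_nonneg n k) (by positivity)) (by positivity)
    _ = _ := by field_simp

theorem tendsto_wzG (n : ℕ) : Tendsto (wzG n) atTop (𝓝 0) := by
  refine squeeze_zero (wzG_nonneg n) (wzG_le n) ?_
  simpa using (tendsto_one_div_add_atTop_nhds_zero_nat (𝕜 := ℝ)).const_mul (wzNum n 1)

theorem tsum_wzF_sub_tsum_wzF (n : ℕ) :
    ∑' k, wzF n k - ∑' k, wzF (n + 1) k = wzG n 0 := by
  have h := ((summable_wzF n).hasSum.sub (summable_wzF (n + 1)).hasSum).tendsto_sum_nat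
  simp only [wzF_sub_wzF, Finset.sum_range_sub'] at h
  exact tendsto_nhds_unique h (by simpa using (tendsto_wzG n).const_sub (wzG n 0))

theorem tendsto_tsum_wzF : Tendsto (fun n => ∑' k, wzF n k) atTop (𝓝 0) := by
  refine squeeze_zero (g := fun n : ℕ => (1 / 2 : ℝ) ^ n * (π ^ 2 / 6))
    (fun n => tsum_nonneg (wzF_nonneg n)) (fun n => ?_) ?_
  · exact hasSum_le (wzF_le n) (summable_wzF n).hasSum (hasSum_one_div_succ_sq.mul_left _)
  · simpa using (tendsto_pow_atTop_nhds_zero_of_lt_one (r := (1 / 2 : ℝ)) (by norm_num)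
      (by norm_num)).mul_const (π ^ 2 / 6)

theorem hasSum_wzG_zero_right : HasSum (fun n => wzG n 0) (π ^ 2 / 6) := by
  rw [hasSum_iff_tendsto_nat_of_nonneg (fun n => wzG_nonneg n 0)]
  simp only [← tsum_wzF_sub_tsum_wzF, Finset.sum_range_sub' (fun n => ∑' k, wzF n k)]
  have h0 : ∑' k, wzF 0 k = π ^ 2 / 6 := by
    simp only [wzF_zero_left, hasSum_one_div_succ_sq.tsum_eq]
  rw [h0]
  simpa using tendsto_tsum_wzF.const_sub (π ^ 2 / 6)

theorem wzG_zero_right (n : ℕ) :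
    wzG n 0 = (poch 1 n) ^ 3 / (poch (1 / 2) n) ^ 3 *
        ((21 * (n : ℝ) ^ 3 + 55 * (n : ℝ) ^ 2 + 47 * (n : ℝ) + 13) /
          (2 * (2 * (n : ℝ) + 1) ^ 3 * (2 * (n : ℝ) + 2) ^ 2)) *
        (1 / 64 : ℝ) ^ n := by
  have h1 : ((2 * n).factorial : ℝ) ≠ 0 := by positivity
  rw [← div_pow, poch_one_div_poch_half, wzG, wzF, wzNum, add_zero, add_zero, Nat.factorial_succ,
    show (64 : ℝ) = 4 ^ 3 by norm_num, one_div, inv_pow, ← pow_mul, mul_comm 3 n, pow_mul]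
  push_cast
  field_simp
  ring

theorem pi_sq_div_six_fast_series :
    π ^ 2 / 6 =
      ∑' n : ℕ, (poch 1 n) ^ 3 / (poch (1 / 2) n) ^ 3 *
        ((21 * (n : ℝ) ^ 3 + 55 * (n : ℝ) ^ 2 + 47 * (n : ℝ) + 13) /
          (2 * (2 * (n : ℝ) + 1) ^ 3 * (2 * (n : ℝ) + 2) ^ 2)) *
        (1 / 64 : ℝ) ^ n := by
  simp only [← wzG_zero_right, hasSum_wzG_zero_right.tsum_eq]
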